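/- arXiv:2409.16989 — 2 statements merged into one kernel-verified Lean document; each statement's English description precedes it below -/
import Mathlib

section
/- Fix ρ ∈ (0,1), an integer n ≥ 1, a strictly decreasing map X₀ : {1,…,n} → ℤ, and for each 0 ≤ k < n let h_k solve the backwards-heat IBVP for (ρ,n,k,X₀). Define G_{0,n}(z₁,z₂) := Σ_{k=0}^{n−1} ((1−ρ)/ρ) Q_ρ^{n−k}(z₁, X₀(n−k)) h_k(0, z₂). Let μ be the product probability measure ⊗_{i=1}^{n−1} ν_ρ on ℕ^{\{1,…,n−1\}}, where ν_ρ({j}) = ρ(1−ρ)^j for j ∈ ℕ; for ω define the leftward walk B_0(ω) := z₁ and B_m(ω) := z₁ − Σ_{i=1}^{m}(ω_i + 1) for 1 ≤ m ≤ n−1, and let τ(ω) be the smallest m ∈ {0,…,n−1} with B_m(ω) > X₀(m+1), with τ(ω) = n if no such m exists. Then for all z₁, z₂ ∈ ℤ: G_{0,n}(z₁,z₂) = ∫ 1_{τ(ω) < n} · \overline{Q}^{(n−τ(ω))}_ρ(B_{τ(ω)}(ω), z₂) dμ(ω). -/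
open MeasureTheory

/-- The geometric kernel `Q_ρ(x,y) = ρ(1−ρ)^{x−y−1}` for `x > y`, `0` otherwise. -/
noncomputable def Qker (ρ : ℝ) (x y : ℤ) : ℝ :=
  if y < x then ρ * (1 - ρ) ^ (x - y - 1) else 0

/-- The `m`-fold convolution power of `Q_ρ`. -/
noncomputable def Qpow (ρ : ℝ) : ℕ → ℤ → ℤ → ℝ
  | 0 => fun x y => if x = y then 1 else 0
  | 1 => Qker ρ
  | n + 2 => fun x y => ∑' z : ℤ, Qker ρ x z * Qpow ρ (n + 1) z y

/-- `\overline{Q}^{(m)}_ρ(x,y) = ρ^m (1−ρ)^{x−y−m} (1/(m−1)!) ∏_{j=1}^{m−1}(x−y−j)`. -/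
noncomputable def Qbar (ρ : ℝ) (m : ℕ) (x y : ℤ) : ℝ :=
  ρ ^ m * (1 - ρ) ^ (x - y - (m : ℤ)) *
    ((Nat.factorial (m - 1) : ℝ)⁻¹ * ∏ j ∈ Finset.Icc 1 (m - 1), ((x - y - (j : ℤ) : ℤ) : ℝ))

/-- `h` solves the backwards-heat initial–boundary value problem for `(ρ, n, k, X₀)`. -/
def SolvesIBVP (ρ : ℝ) (n k : ℕ) (X₀ : ℕ → ℤ) (h : ℕ → ℤ → ℝ) : Prop :=
  (∀ l, l < k → ∀ z : ℤ, (1 / ρ) * h l (z - 1) - ((1 - ρ) / ρ) * h l z = h (l + 1) z) ∧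
  (∀ z : ℤ, h k z = ρ * (1 - ρ) ^ (X₀ (n - k) - z - 1)) ∧
  (∀ l, l < k → h l (X₀ (n - l)) = 0)

/-- The geometric distribution `ν_ρ` on `ℕ` with `ν_ρ({j}) = ρ(1−ρ)^j`. -/
noncomputable def geomMeasure (ρ : ℝ) : Measure ℕ :=
  Measure.sum fun j : ℕ => (ENNReal.ofReal (ρ * (1 - ρ) ^ j)) • Measure.dirac j

/-- The leftward walk: `B_0(ω) = z₁` and `B_m(ω) = z₁ − Σ_{i=1}^{m}(ω_i + 1)` for
`1 ≤ m ≤ n−1`, where the coordinate of index `i ∈ {1,…,n−1}` is `ω ⟨i−1⟩`. -/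
noncomputable def walkB (n : ℕ) (z₁ : ℤ) (ω : Fin (n - 1) → ℕ) (m : ℕ) : ℤ :=
  z₁ - ∑ i ∈ Finset.filter (fun i : Fin (n - 1) => (i : ℕ) + 1 ≤ m) Finset.univ, ((ω i : ℤ) + 1)

/-- The hitting time `τ(ω)`: the smallest `m ∈ {0,…,n−1}` with `B_m(ω) > X₀(m+1)`,
and `n` if there is no such `m`. -/
noncomputable def walkTau (n : ℕ) (X₀ : ℕ → ℤ) (z₁ : ℤ) (ω : Fin (n - 1) → ℕ) : ℕ :=
  sInf ({m : ℕ | m ≤ n - 1 ∧ X₀ (m + 1) < walkB n z₁ ω m} ∪ {n})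

/-- `G_{0,n}(z₁,z₂) := Σ_{k=0}^{n−1} ((1−ρ)/ρ) Q_ρ^{n−k}(z₁, X₀(n−k)) h_k(0, z₂)`. -/
noncomputable def Gop (ρ : ℝ) (n : ℕ) (X₀ : ℕ → ℤ) (h : ℕ → ℕ → ℤ → ℝ) (z₁ z₂ : ℤ) : ℝ :=
  ∑ k ∈ Finset.range n, ((1 - ρ) / ρ) * Qpow ρ (n - k) z₁ (X₀ (n - k)) * h k 0 z₂

lemma Qbar_shift (ρ : ℝ) (m : ℕ) (x y : ℤ) : Qbar ρ m x (y - 1) = Qbar ρ m (x + 1) y := by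
  have : x - (y - 1) = x + 1 - y := by ring
  simp only [Qbar, this]

lemma prod_Icc_sub_succ (u : ℝ) (m : ℕ) :
    ∏ j ∈ Finset.Icc 1 (m + 1), (u + 1 - (j : ℝ)) = u * ∏ j ∈ Finset.Icc 1 m, (u - (j : ℝ)) := by
  induction m with
  | zero => simp
  | succ m ih =>
    rw [Finset.prod_Icc_succ_top (by lia), ih, Finset.prod_Icc_succ_top (by lia)]
    push_cast
    ring

lemma Qbar_succ_left {ρ : ℝ} (hρ : ρ ≠ 1) (m : ℕ) (x y : ℤ) :
    Qbar ρ (m + 2) (x + 1) y = ρ * Qbar ρ (m + 1) x y + (1 - ρ) * Qbar ρ (m + 2) x y := by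
  have h1 : (1 - ρ) ≠ 0 := sub_ne_zero.2 hρ.symm
  have e1 : x + 1 - y - ((m + 2 : ℕ) : ℤ) = (x - y - ((m + 2 : ℕ) : ℤ)) + 1 := by ring
  have e2 : x - y - ((m + 1 : ℕ) : ℤ) = (x - y - ((m + 2 : ℕ) : ℤ)) + 1 := by push_cast; ring
  have p1 := prod_Icc_sub_succ ((x : ℝ) - y) m
  have p2 := Finset.prod_Icc_succ_top (show 1 ≤ m + 1 by lia) fun j : ℕ => (x : ℝ) - y - j
  have e3 : (x : ℝ) + 1 - y = x - y + 1 := by ring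
  simp only [Qbar, e1, e2, zpow_add_one₀ h1, show m + 2 - 1 = m + 1 from rfl,
    Nat.add_sub_cancel, Nat.factorial_succ]
  push_cast
  rw [e3, p1, p2]
  have : ((m : ℝ) + 1) ≠ 0 := by positivity
  have : (m.factorial : ℝ) ≠ 0 := by positivity
  push_cast
  field_simp
  ring

lemma tsum_Qker_mul (ρ : ℝ) (x : ℤ) (g : ℤ → ℝ) :
    ∑' z : ℤ, Qker ρ x z * g z = ∑' a : ℕ, ρ * (1 - ρ) ^ a * g (x - 1 - a) := by
  have hinj : Function.Injective fun a : ℕ => x - 1 - (a : ℤ) := fun a b hab => by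
    simp only at hab
    lia
  rw [← hinj.tsum_eq]
  · refine tsum_congr fun a => ?_
    have : x - (x - 1 - (a : ℤ)) - 1 = a := by ring
    simp only [Qker, this, if_pos (show x - 1 - (a : ℤ) < x by lia), zpow_natCast]
  · intro z hz
    have hzx : z < x := by
      by_contra hcon
      simp [Qker, hcon] at hz
    exact ⟨(x - 1 - z).toNat, by simp only; lia⟩

lemma Qpow_succ_succ (ρ : ℝ) (m : ℕ) (x y : ℤ) :
    Qpow ρ (m + 2) x y = ∑' a : ℕ, ρ * (1 - ρ) ^ a * Qpow ρ (m + 1) (x - 1 - a) y :=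
  tsum_Qker_mul ρ x fun z => Qpow ρ (m + 1) z y

lemma Qpow_of_le (ρ : ℝ) (m : ℕ) {x y : ℤ} (hxy : x ≤ y) : Qpow ρ (m + 1) x y = 0 := by
  induction m generalizing x with
  | zero => simp [Qpow, Qker, not_lt.2 hxy]
  | succ m ih =>
    rw [Qpow_succ_succ, ← tsum_zero (α := ℝ) (β := ℕ)]
    refine tsum_congr fun a => ?_
    rw [ih (by lia), mul_zero]

lemma summable_Qpow (ρ : ℝ) (m : ℕ) (x y : ℤ) :
    Summable fun a : ℕ => ρ * (1 - ρ) ^ a * Qpow ρ (m + 1) (x - 1 - a) y := by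
  refine summable_of_ne_finset_zero (s := Finset.range (x - y).toNat) fun a ha => ?_
  rw [Finset.mem_range] at ha
  rw [Qpow_of_le _ _ (by lia), mul_zero]

lemma Qpow_succ_left (ρ : ℝ) (m : ℕ) (x y : ℤ) :
    Qpow ρ (m + 2) (x + 1) y = ρ * Qpow ρ (m + 1) x y + (1 - ρ) * Qpow ρ (m + 2) x y := by
  rw [Qpow_succ_succ, (summable_Qpow ρ m (x + 1) y).tsum_eq_zero_add, Qpow_succ_succ,
    ← tsum_mul_left]
  congr 1
  · simp
  · refine tsum_congr fun a => ?_
    have : x + 1 - 1 - ((a + 1 : ℕ) : ℤ) = x - 1 - a := by push_cast; ring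
    rw [this]
    ring

lemma Qpow_eq_Qbar {ρ : ℝ} (hρ : ρ ≠ 1) (m : ℕ) {x y : ℤ} (hxy : y < x) :
    Qpow ρ (m + 1) x y = Qbar ρ (m + 1) x y := by
  induction m generalizing x with
  | zero => simp [Qpow, Qker, Qbar, hxy]
  | succ m ih =>
    induction x, (Int.add_one_le_iff.2 hxy) using Int.leInduction with
    | base =>
      rw [Qpow_succ_left, Qpow_of_le _ _ le_rfl, Qpow_of_le _ _ le_rfl, Qbar,
        Finset.prod_eq_zero (i := 1) (by simp) (by simp)]
      simp
    | succ x hx ihx =>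
      rw [Qpow_succ_left, ih (by lia), ihx (by lia), Qbar_succ_left hρ]

lemma eq_zero_of_backward_recursion {c : ℝ} (hc : c ≠ 0) {d : ℤ → ℝ} (a : ℤ) (ha : d a = 0)
    (hd : ∀ z, d (z - 1) = c * d z) (z : ℤ) : d z = 0 := by
  induction z using Int.inductionOn' (b := a) with
  | zero => exact ha
  | succ k _ ih =>
    have := hd (k + 1)
    rw [add_sub_cancel_right, ih] at this
    exact (mul_eq_zero.1 this.symm).resolve_left hc
  | pred k _ ih => rw [hd, ih, mul_zero]

/-- To the right of the whole curve, `G_{0,n}` is the analytic extension of `Q^n`. -/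
lemma Gop_eq_Qbar {ρ : ℝ} (hρ : ρ ∈ Set.Ioo (0 : ℝ) 1) (X₀ : ℕ → ℤ) (N : ℕ)
    (h : ℕ → ℕ → ℤ → ℝ) (hh : ∀ k, k < N + 1 → SolvesIBVP ρ (N + 1) k X₀ (h k))
    (z₁ : ℤ) (hz : ∀ i, 1 ≤ i → i ≤ N + 1 → X₀ i < z₁) (z₂ : ℤ) :
    Gop ρ (N + 1) X₀ h z₁ z₂ = Qbar ρ (N + 1) z₁ z₂ := by
  have h0 : ρ ≠ 0 := hρ.1.ne'
  have h1 : ρ ≠ 1 := hρ.2.ne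
  have h1' : (1 - ρ) ≠ 0 := sub_ne_zero.2 h1.symm
  have hterm : ∀ M z, ((1 - ρ) / ρ) * Qpow ρ (M + 1) z₁ (X₀ (M + 1)) *
      (ρ * (1 - ρ) ^ (X₀ (M + 1) - z - 1)) =
        Qpow ρ (M + 1) z₁ (X₀ (M + 1)) * (1 - ρ) ^ (X₀ (M + 1) - z) := by
    intro M z
    rw [zpow_sub_one₀ h1']
    field_simp
  induction N generalizing h z₂ with
  | zero =>
    have e := (hh 0 (by lia)).2.1 z₂
    simp only [Gop, Finset.sum_range_one, e, Nat.sub_zero, zero_add]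
    rw [hterm 0, Qpow_eq_Qbar h1 _ (hz 1 le_rfl le_rfl)]
    simp only [Qbar]
    have : z₁ - z₂ - ((0 + 1 : ℕ) : ℤ)
      = (z₁ - X₀ (0 + 1) - ((0 + 1 : ℕ) : ℤ)) + (X₀ (0 + 1) - z₂) := by ring
    rw [this, zpow_add₀ h1']
    simp
    ring
  | succ N ih =>
    have hrec : ∀ z, (1 / ρ) * Gop ρ (N + 2) X₀ h z₁ (z - 1)
        - ((1 - ρ) / ρ) * Gop ρ (N + 2) X₀ h z₁ z = Qbar ρ (N + 1) z₁ z := by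
      intro z
      rw [← ih (fun k l => h (k + 1) (l + 1)) ?_ (fun i hi hi' => hz i hi (by lia)) z]
      · have e0 : (1 / ρ) * h 0 0 (z - 1) - ((1 - ρ) / ρ) * h 0 0 z = 0 := by
          rw [(hh 0 (by lia)).2.1, (hh 0 (by lia)).2.1]
          have : X₀ (N + 1 + 1 - 0) - (z - 1) - 1 = (X₀ (N + 1 + 1 - 0) - z - 1) + 1 := by ring
          rw [this, zpow_add_one₀ h1']
          field_simp
          ring
        simp only [Gop, Finset.sum_range_succ' _ (N + 1)]
        rw [mul_add, mul_add, add_sub_add_comm, Finset.mul_sum, Finset.mul_sum,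
          ← Finset.sum_sub_distrib]
        have e1 : ∀ c : ℝ, (1 / ρ) * (c * h 0 0 (z - 1)) - ((1 - ρ) / ρ) * (c * h 0 0 z) = 0 := by
          intro c
          linear_combination c * e0
        rw [e1, add_zero]
        refine Finset.sum_congr rfl fun k hk => ?_
        rw [← (hh (k + 1) (by simpa using hk)).1 0 (by lia) z,
          show N + 2 - (k + 1) = N + 1 - k by lia]
        ring
      · intro k hk
        obtain ⟨H1, H2, H3⟩ := hh (k + 1) (by lia)
        refine ⟨fun l hl z => H1 (l + 1) (by lia) z, fun z => ?_, fun l hl => ?_⟩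
        · simpa only [Nat.add_sub_add_right] using H2 z
        · simpa only [Nat.add_sub_add_right] using H3 (l + 1) (by lia)
    rw [← sub_eq_zero]
    refine eq_zero_of_backward_recursion h1'
      (d := fun z => Gop ρ (N + 2) X₀ h z₁ z - Qbar ρ (N + 2) z₁ z) (X₀ (N + 2)) ?_ ?_ z₂
    · have e : Gop ρ (N + 2) X₀ h z₁ (X₀ (N + 2)) = Qpow ρ (N + 2) z₁ (X₀ (N + 2)) := by
        simp only [Gop, Finset.sum_range_succ' _ (N + 1)]
        rw [Finset.sum_eq_zero, (hh 0 (by lia)).2.1, zero_add, Nat.sub_zero, hterm (N + 1)]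
        · simp
        · intro k hk
          have := (hh (k + 1) (by simpa using hk)).2.2 0 (by lia)
          rw [Nat.sub_zero] at this
          rw [this, mul_zero]
      simp only [e]
      rw [Qpow_eq_Qbar h1 _ (hz _ (by lia) le_rfl), sub_self]
    · intro z
      have := hrec z
      simp only [Qbar_shift, Qbar_succ_left h1]
      field_simp at this
      linear_combination this

lemma Gop_of_le {ρ : ℝ} (X₀ : ℕ → ℤ) (N : ℕ) (h : ℕ → ℕ → ℤ → ℝ) {z₁ : ℤ} (hz : z₁ ≤ X₀ 1)
    (z₂ : ℤ) : Gop ρ (N + 2) X₀ h z₁ z₂ =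
      ∑ k ∈ Finset.range (N + 1), ((1 - ρ) / ρ) * Qpow ρ (N - k + 2) z₁ (X₀ (N - k + 2)) *
        h k 0 z₂ := by
  rw [Gop, Finset.sum_range_succ]
  have : N + 2 - (N + 1) = 0 + 1 := by lia
  rw [this, Qpow_of_le _ _ hz, mul_zero, zero_mul, add_zero]
  refine Finset.sum_congr rfl fun k hk => ?_
  rw [Finset.mem_range] at hk
  rw [show N + 2 - k = N - k + 2 by lia]

instance {ρ : ℝ} [hρ : Fact (ρ ∈ Set.Ioo (0 : ℝ) 1)] :
    IsProbabilityMeasure (geomMeasure ρ) := by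
  obtain ⟨h0, h1⟩ := hρ.out
  have hs : HasSum (fun j : ℕ => ρ * (1 - ρ) ^ j) 1 := by
    have := (hasSum_geometric_of_lt_one (r := 1 - ρ) (by linarith) (by linarith)).mul_left ρ
    rwa [sub_sub_cancel, mul_inv_cancel₀ h0.ne'] at this
  constructor
  rw [geomMeasure, Measure.sum_apply _ MeasurableSet.univ]
  simp only [Measure.smul_apply, measure_univ, smul_eq_mul, mul_one]
  rw [← ENNReal.ofReal_tsum_of_nonneg (fun j => ?_) hs.summable, hs.tsum_eq, ENNReal.ofReal_one]
  have : 0 ≤ 1 - ρ := by linarith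
  positivity

lemma integral_geomMeasure {ρ : ℝ} (hρ : ρ ∈ Set.Ioo (0 : ℝ) 1) {f : ℕ → ℝ}
    (hf : Integrable f (geomMeasure ρ)) :
    ∫ a, f a ∂(geomMeasure ρ) = ∑' a : ℕ, ρ * (1 - ρ) ^ a * f a := by
  rw [geomMeasure, integral_sum_measure hf]
  refine tsum_congr fun a => ?_
  have h0 := hρ.1
  have : 0 ≤ 1 - ρ := by linarith [hρ.2]
  rw [integral_smul_measure, integral_dirac, ENNReal.toReal_ofReal (by positivity), smul_eq_mul]

lemma integrable_Qpow {ρ : ℝ} (hρ : ρ ∈ Set.Ioo (0 : ℝ) 1) (m : ℕ) (x y : ℤ) :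
    Integrable (fun a : ℕ => Qpow ρ (m + 1) (x - 1 - a) y) (geomMeasure ρ) := by
  have := Fact.mk hρ
  refine Integrable.of_bound (C := ∑ a ∈ Finset.range (x - y).toNat,
    ‖Qpow ρ (m + 1) (x - 1 - a) y‖) .of_discrete (.of_forall fun a => ?_)
  by_cases ha : a ∈ Finset.range (x - y).toNat
  · exact Finset.single_le_sum (f := fun a : ℕ => ‖Qpow ρ (m + 1) (x - 1 - a) y‖)
      (fun _ _ => norm_nonneg _) ha
  · rw [Finset.mem_range] at ha
    rw [Qpow_of_le _ _ (by lia), norm_zero]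
    positivity

lemma integral_Qpow {ρ : ℝ} (hρ : ρ ∈ Set.Ioo (0 : ℝ) 1) (m : ℕ) (x y : ℤ) :
    ∫ a : ℕ, Qpow ρ (m + 1) (x - 1 - a) y ∂(geomMeasure ρ) = Qpow ρ (m + 2) x y := by
  rw [integral_geomMeasure hρ (integrable_Qpow hρ m x y), Qpow_succ_succ]

/-- Left of the first point of the curve, `G_{0,n}` is obtained by taking one step of the walk. -/
lemma Gop_eq_integral {ρ : ℝ} (hρ : ρ ∈ Set.Ioo (0 : ℝ) 1) (X₀ : ℕ → ℤ) (N : ℕ)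
    (h : ℕ → ℕ → ℤ → ℝ) {z₁ : ℤ} (hz : z₁ ≤ X₀ 1) (z₂ : ℤ) :
    Gop ρ (N + 2) X₀ h z₁ z₂ =
      ∫ a : ℕ, Gop ρ (N + 1) (fun i => X₀ (i + 1)) h (z₁ - 1 - a) z₂ ∂(geomMeasure ρ) := by
  have e : ∀ z, Gop ρ (N + 1) (fun i => X₀ (i + 1)) h z z₂ = ∑ k ∈ Finset.range (N + 1),
      ((1 - ρ) / ρ) * Qpow ρ (N - k + 1) z (X₀ (N - k + 2)) * h k 0 z₂ := fun z =>
    Finset.sum_congr rfl fun k hk => by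
      rw [Finset.mem_range] at hk
      rw [show N + 1 - k = N - k + 1 by lia]
  rw [Gop_of_le X₀ N h hz]
  simp only [e]
  rw [integral_finsetSum _ fun k _ =>
    ((integrable_Qpow hρ (N - k) z₁ (X₀ (N - k + 2))).const_mul _).mul_const _]
  refine Finset.sum_congr rfl fun k _ => ?_
  rw [integral_mul_const, integral_const_mul, integral_Qpow hρ]

lemma walkB_zero (n : ℕ) (z₁ : ℤ) (ω : Fin (n - 1) → ℕ) : walkB n z₁ ω 0 = z₁ := by
  simp [walkB]

lemma walkB_cons (N : ℕ) (z₁ : ℤ) (a : ℕ) (ω : Fin N → ℕ) (m : ℕ) :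
    walkB (N + 2) z₁ (Fin.cons a ω : Fin (N + 1) → ℕ) (m + 1) =
      walkB (N + 1) (z₁ - 1 - a) ω m := by
  simp only [walkB, Finset.sum_filter]
  change z₁ - (∑ i : Fin (N + 1),
    if (i : ℕ) + 1 ≤ m + 1 then (((Fin.cons a ω : Fin (N + 1) → ℕ) i : ℕ) : ℤ) + 1 else 0) = _
  rw [Fin.sum_univ_succ]
  simp
  ring

lemma walkB_le (n : ℕ) (z₁ : ℤ) (ω : Fin (n - 1) → ℕ) (m : ℕ) : walkB n z₁ ω m ≤ z₁ := by
  have : 0 ≤ ∑ i ∈ Finset.filter (fun i : Fin (n - 1) => (i : ℕ) + 1 ≤ m) Finset.univ,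
      ((ω i : ℤ) + 1) := by positivity
  simp only [walkB]
  lia

lemma walkTau_of_lt (n : ℕ) (X₀ : ℕ → ℤ) (z₁ : ℤ) (ω : Fin (n - 1) → ℕ) (hz : X₀ 1 < z₁) :
    walkTau n X₀ z₁ ω = 0 :=
  Nat.le_zero.1 (Nat.sInf_le (Or.inl ⟨Nat.zero_le _, by simpa [walkB_zero] using hz⟩))

lemma walkTau_cons (N : ℕ) (X₀ : ℕ → ℤ) (z₁ : ℤ) (a : ℕ) (ω : Fin N → ℕ) (hz : z₁ ≤ X₀ 1) :
    walkTau (N + 2) X₀ z₁ (Fin.cons a ω : Fin (N + 1) → ℕ) =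
      walkTau (N + 1) (fun i => X₀ (i + 1)) (z₁ - 1 - a) ω + 1 := by
  set S : Set ℕ := {m : ℕ | m ≤ N + 2 - 1 ∧ X₀ (m + 1) <
    walkB (N + 2) z₁ (Fin.cons a ω : Fin (N + 1) → ℕ) m} ∪ {N + 2} with hS
  have h1 : 1 ≤ sInf {m | m ∈ S} := by
    refine le_csInf ⟨N + 2, Or.inr rfl⟩ fun m hm => ?_
    rcases hm with ⟨_, hm⟩ | hm
    · rcases m with _ | m
      · rw [walkB_zero] at hm
        lia
      · lia
    · rw [Set.mem_singleton_iff] at hm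
      lia
  have h2 := Nat.sInf_add h1
  simp only [Set.ofPred_mem_eq] at h2
  rw [walkTau, ← hS, ← h2, walkTau]
  congr 2
  ext m
  simp [hS, walkB_cons]

lemma lt_walkB_walkTau {n : ℕ} {X₀ : ℕ → ℤ} {z₁ : ℤ} {ω : Fin (n - 1) → ℕ}
    (hτ : walkTau n X₀ z₁ ω < n) :
    X₀ (walkTau n X₀ z₁ ω + 1) < walkB n z₁ ω (walkTau n X₀ z₁ ω) := by
  have : walkTau n X₀ z₁ ω ∈ _ := Nat.sInf_mem (s := {m : ℕ | m ≤ n - 1 ∧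
    X₀ (m + 1) < walkB n z₁ ω m} ∪ {n}) ⟨n, Or.inr rfl⟩
  rcases this with hm | hm
  · exact hm.2
  · exact absurd hm hτ.ne

/-- The extension of `Q^{n-τ}` evaluated at the position of the walk at its hitting time. -/
noncomputable def hitQbar (ρ : ℝ) (n : ℕ) (X₀ : ℕ → ℤ) (z₁ z₂ : ℤ) (ω : Fin (n - 1) → ℕ) : ℝ :=
  if walkTau n X₀ z₁ ω < n then
    Qbar ρ (n - walkTau n X₀ z₁ ω) (walkB n z₁ ω (walkTau n X₀ z₁ ω)) z₂
  else 0

lemma hitQbar_of_lt (ρ : ℝ) {n : ℕ} (hn : 1 ≤ n) {X₀ : ℕ → ℤ} {z₁ : ℤ} (hz : X₀ 1 < z₁) (z₂ : ℤ)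
    (ω : Fin (n - 1) → ℕ) : hitQbar ρ n X₀ z₁ z₂ ω = Qbar ρ n z₁ z₂ := by
  rw [hitQbar, walkTau_of_lt _ _ _ _ hz, if_pos (show 0 < n from hn), walkB_zero, Nat.sub_zero]

lemma hitQbar_cons (ρ : ℝ) (N : ℕ) {X₀ : ℕ → ℤ} {z₁ : ℤ} (hz : z₁ ≤ X₀ 1) (z₂ : ℤ)
    (a : ℕ) (ω : Fin N → ℕ) :
    hitQbar ρ (N + 2) X₀ z₁ z₂ (Fin.cons a ω : Fin (N + 1) → ℕ) =
      hitQbar ρ (N + 1) (fun i => X₀ (i + 1)) (z₁ - 1 - a) z₂ ω := by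
  simp only [hitQbar, walkTau_cons _ _ _ _ _ hz, walkB_cons, add_lt_add_iff_right,
    show N + 2 = N + 1 + 1 from rfl, Nat.add_sub_add_right]

lemma norm_hitQbar_le (ρ : ℝ) (n : ℕ) (X₀ : ℕ → ℤ) (z₁ z₂ : ℤ) (ω : Fin (n - 1) → ℕ) :
    ‖hitQbar ρ n X₀ z₁ z₂ ω‖ ≤ ∑ m ∈ Finset.range n, ∑ b ∈ Finset.Ioc (X₀ (m + 1)) z₁,
      ‖Qbar ρ (n - m) b z₂‖ := by
  rw [hitQbar]
  split_ifs with hτ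
  · refine le_trans ?_ (Finset.single_le_sum (f := fun m => ∑ b ∈ Finset.Ioc (X₀ (m + 1)) z₁,
      ‖Qbar ρ (n - m) b z₂‖) (fun _ _ => by positivity) (Finset.mem_range.2 hτ))
    exact Finset.single_le_sum (f := fun b => ‖Qbar ρ (n - walkTau n X₀ z₁ ω) b z₂‖)
      (fun _ _ => norm_nonneg _) (Finset.mem_Ioc.2 ⟨lt_walkB_walkTau hτ, walkB_le _ _ _ _⟩)
  · rw [norm_zero]
    positivity

lemma Gop_eq_integral_hitQbar_of_lt {ρ : ℝ} (hρ : ρ ∈ Set.Ioo (0 : ℝ) 1) (N : ℕ) (X₀ : ℕ → ℤ)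
    (hX : ∀ i j : ℕ, 1 ≤ i → i < j → j ≤ N + 1 → X₀ j < X₀ i)
    (h : ℕ → ℕ → ℤ → ℝ) (hh : ∀ k, k < N + 1 → SolvesIBVP ρ (N + 1) k X₀ (h k))
    {z₁ : ℤ} (hz : X₀ 1 < z₁) (z₂ : ℤ) :
    Gop ρ (N + 1) X₀ h z₁ z₂ = ∫ ω : Fin N → ℕ, hitQbar ρ (N + 1) X₀ z₁ z₂ ω
      ∂(Measure.pi fun _ : Fin N => geomMeasure ρ) := by
  have := Fact.mk hρ
  have e : ∀ ω : Fin N → ℕ, hitQbar ρ (N + 1) X₀ z₁ z₂ ω = Qbar ρ (N + 1) z₁ z₂ :=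
    hitQbar_of_lt ρ (Nat.le_add_left 1 N) hz z₂
  simp only [e, integral_const, probReal_univ, one_smul]
  refine Gop_eq_Qbar hρ X₀ N h hh z₁ (fun i hi hi' => ?_) z₂
  rcases hi.eq_or_lt with rfl | hi1
  · exact hz
  · exact (hX 1 i le_rfl hi1 hi').trans hz

lemma integrable_hitQbar {ρ : ℝ} (hρ : ρ ∈ Set.Ioo (0 : ℝ) 1) (N : ℕ) (X₀ : ℕ → ℤ)
    (z₁ z₂ : ℤ) : Integrable (fun ω : Fin N → ℕ => hitQbar ρ (N + 1) X₀ z₁ z₂ ω)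
      (Measure.pi fun _ : Fin N => geomMeasure ρ) := by
  have := Fact.mk hρ
  exact .of_bound .of_discrete _ (.of_forall (norm_hitQbar_le ρ (N + 1) X₀ z₁ z₂))

/-- One step of the walk conditions on its first increment. -/
lemma integral_hitQbar_succ {ρ : ℝ} (hρ : ρ ∈ Set.Ioo (0 : ℝ) 1) (N : ℕ) (X₀ : ℕ → ℤ)
    {z₁ : ℤ} (hz : z₁ ≤ X₀ 1) (z₂ : ℤ) :
    ∫ ω : Fin (N + 1) → ℕ, hitQbar ρ (N + 2) X₀ z₁ z₂ ω
      ∂(Measure.pi fun _ : Fin (N + 1) => geomMeasure ρ) =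
    ∫ a : ℕ, ∫ ω : Fin N → ℕ, hitQbar ρ (N + 1) (fun i => X₀ (i + 1)) (z₁ - 1 - a) z₂ ω
      ∂(Measure.pi fun _ : Fin N => geomMeasure ρ) ∂(geomMeasure ρ) := by
  have := Fact.mk hρ
  have hmp := (measurePreserving_piFinSuccAbove (fun _ : Fin (N + 1) => geomMeasure ρ) 0).symm
  have hint : Integrable (fun x : ℕ × (Fin N → ℕ) => hitQbar ρ (N + 2) X₀ z₁ z₂
      ((MeasurableEquiv.piFinSuccAbove (fun _ : Fin (N + 1) => ℕ) 0).symm x)) _ :=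
    (hmp.integrable_comp_emb (MeasurableEquiv.measurableEmbedding _)).2
    (integrable_hitQbar hρ (N + 1) X₀ z₁ z₂)
  rw [← hmp.integral_comp', integral_prod _ hint]
  refine integral_congr_ae (.of_forall fun a => integral_congr_ae (.of_forall fun ω => ?_))
  rw [← hitQbar_cons ρ N hz]
  simp only [MeasurableEquiv.piFinSuccAbove_symm_apply, Fin.insertNthEquiv, Equiv.coe_fn_mk,
    Fin.insertNth_zero]
  rfl

lemma Gop_eq_integral_hitQbar {ρ : ℝ} (hρ : ρ ∈ Set.Ioo (0 : ℝ) 1) (N : ℕ) (X₀ : ℕ → ℤ)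
    (hX : ∀ i j : ℕ, 1 ≤ i → i < j → j ≤ N + 1 → X₀ j < X₀ i)
    (h : ℕ → ℕ → ℤ → ℝ) (hh : ∀ k, k < N + 1 → SolvesIBVP ρ (N + 1) k X₀ (h k)) (z₁ z₂ : ℤ) :
    Gop ρ (N + 1) X₀ h z₁ z₂ = ∫ ω : Fin N → ℕ, hitQbar ρ (N + 1) X₀ z₁ z₂ ω
      ∂(Measure.pi fun _ : Fin N => geomMeasure ρ) := by
  induction N generalizing X₀ z₁ with
  | zero =>
    rcases lt_or_ge (X₀ 1) z₁ with hz | hz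
    · exact Gop_eq_integral_hitQbar_of_lt hρ 0 X₀ hX h hh hz z₂
    have hτ : ∀ ω : Fin 0 → ℕ, hitQbar ρ (0 + 1) X₀ z₁ z₂ ω = 0 := by
      intro ω
      rw [hitQbar, if_neg]
      intro hlt
      have := lt_walkB_walkTau hlt
      rw [Nat.lt_one_iff.1 hlt, walkB_zero] at this
      lia
    simp only [hτ, integral_zero]
    rw [Gop, Finset.sum_range_one, Nat.sub_zero, Qpow_of_le _ _ hz, mul_zero, zero_mul]
  | succ N ih =>
    rcases lt_or_ge (X₀ 1) z₁ with hz | hz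
    · exact Gop_eq_integral_hitQbar_of_lt hρ (N + 1) X₀ hX h hh hz z₂
    rw [Gop_eq_integral hρ X₀ N h hz, integral_hitQbar_succ hρ N X₀ hz]
    refine integral_congr_ae (.of_forall fun a =>
      ih _ (fun i j hi hij hj => hX _ _ (by lia) (by lia) (by lia)) (fun k hk => ?_) _)
    obtain ⟨H1, H2, H3⟩ := hh k (by lia)
    refine ⟨H1, fun z => ?_, fun l hl => ?_⟩
    · simp only [H2, show N + 1 - k + 1 = N + 1 + 1 - k by lia]
    · simp only [show N + 1 - l + 1 = N + 1 + 1 - l by lia, H3 l hl]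

theorem stmt11 (ρ : ℝ) (hρ : ρ ∈ Set.Ioo (0 : ℝ) 1) (n : ℕ) (hn : 1 ≤ n)
    (X₀ : ℕ → ℤ) (hX : ∀ i j : ℕ, 1 ≤ i → i < j → j ≤ n → X₀ j < X₀ i)
    (h : ℕ → ℕ → ℤ → ℝ) (hh : ∀ k, k < n → SolvesIBVP ρ n k X₀ (h k))
    (z₁ z₂ : ℤ) :
    Gop ρ n X₀ h z₁ z₂
      = ∫ ω, (if walkTau n X₀ z₁ ω < n then
            Qbar ρ (n - walkTau n X₀ z₁ ω) (walkB n z₁ ω (walkTau n X₀ z₁ ω)) z₂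
          else 0)
          ∂(Measure.pi fun _ : Fin (n - 1) => geomMeasure ρ) := by
  obtain ⟨N, rfl⟩ : ∃ N, n = N + 1 := ⟨n - 1, by lia⟩
  exact Gop_eq_integral_hitQbar hρ N X₀ hX h hh z₁ z₂
end

section
/- Fix ρ ∈ (0,1), t > 0, an integer n ≥ 1 and a strictly decreasing map X₀ : {1,…,n} → ℤ, and for each 0 ≤ k ≤ n−1 let h_k solve the backwards-heat IBVP for (ρ,n,k,X₀), with Ψ^n_{ρ,k} and Φ^n_{ρ,k} defined as below. Define G_{0,n}(z₁,z₂) := Σ_{k=0}^{n−1} ((1−ρ)/ρ) Q_ρ^{n−k}(z₁, X₀(n−k)) h_k(0, z₂) and (R_{ρ,t}Q_ρ^{-n})(x,z₁) := Σ_{y∈ℤ} R_{ρ,t}(x,y)Q_ρ^{-n}(y,z₁). Then for all x, y ∈ ℤ: Σ_{k=0}^{n−1} Ψ^n_{ρ,k}(x)·Φ^n_{ρ,k}(y) = Σ_{z₂∈ℤ} ( Σ_{z₁∈ℤ} (R_{ρ,t}Q_ρ^{-n})(x,z₁)·G_{0,n}(z₁,z₂) )·R_{ρ,t}^{-1}(z₂,y),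 where the inner sum over z₁ has finitely many nonzero terms and the sum over z₂ converges absolutely. -/
/-- `R_{ρ,t}(x,y) = e^{−t}(1−ρ)^{x−y} t^{x−y}/(x−y)!` for `x ≥ y`, `0` otherwise. -/
noncomputable def Rker (ρ t : ℝ) (x y : ℤ) : ℝ :=
  if y ≤ x then
    Real.exp (-t) * (1 - ρ) ^ (x - y) * t ^ (x - y).toNat / (Nat.factorial (x - y).toNat)
  else 0

/-- `R_{ρ,t}^{-1}(x,y) = e^{t}(1−ρ)^{x−y}(−t)^{x−y}/(x−y)!` for `x ≥ y`, `0` otherwise. -/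
noncomputable def Rinv (ρ t : ℝ) (x y : ℤ) : ℝ :=
  if y ≤ x then
    Real.exp t * (1 - ρ) ^ (x - y) * (-t) ^ (x - y).toNat / (Nat.factorial (x - y).toNat)
  else 0

/-- `Q_ρ^{-1}(x,y) = (1/ρ)·1_{x=y−1} − ((1−ρ)/ρ)·1_{x=y}`. -/
noncomputable def Qinv (ρ : ℝ) (x y : ℤ) : ℝ :=
  (1 / ρ) * (if x = y - 1 then 1 else 0) - ((1 - ρ) / ρ) * (if x = y then 1 else 0)

/-- `Q_ρ^{-k}`, the `k`-fold convolution power of `Q_ρ^{-1}`, with `Q_ρ^{-0}` the identity. -/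
noncomputable def Qinvpow (ρ : ℝ) : ℕ → ℤ → ℤ → ℝ
  | 0 => fun x y => if x = y then 1 else 0
  | k + 1 => fun x y => ∑' z : ℤ, Qinv ρ x z * Qinvpow ρ k z y

/-- `Ψ^n_{ρ,k}(x) := Σ_y R_{ρ,t}(x,y) Q_ρ^{-k}(y, X₀(n−k))`. -/
noncomputable def Psi (ρ t : ℝ) (n k : ℕ) (X₀ : ℕ → ℤ) (x : ℤ) : ℝ :=
  ∑' y : ℤ, Rker ρ t x y * Qinvpow ρ k y (X₀ (n - k))

/-- `Φ^n_{ρ,k}(z) := Σ_y ((1−ρ)/ρ) h_k(0,y) R_{ρ,t}^{-1}(y,z)`. -/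
noncomputable def Phi (ρ t : ℝ) (hk0 : ℤ → ℝ) (z : ℤ) : ℝ :=
  ∑' y : ℤ, ((1 - ρ) / ρ) * hk0 y * Rinv ρ t y z

/-- `(R_{ρ,t}Q_ρ^{-n})(x,z₁) := Σ_y R_{ρ,t}(x,y) Q_ρ^{-n}(y,z₁)`. -/
noncomputable def RQinv (ρ t : ℝ) (n : ℕ) (x z₁ : ℤ) : ℝ :=
  ∑' y : ℤ, Rker ρ t x y * Qinvpow ρ n y z₁

theorem Qker_eq_zero {ρ : ℝ} {x y : ℤ} (hxy : x ≤ y) : Qker ρ x y = 0 :=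
  if_neg hxy.not_gt

theorem Rker_eq_zero {ρ t : ℝ} {x y : ℤ} (hxy : x < y) : Rker ρ t x y = 0 :=
  if_neg hxy.not_ge

theorem Rinv_eq_zero {ρ t : ℝ} {x y : ℤ} (hxy : x < y) : Rinv ρ t x y = 0 :=
  if_neg hxy.not_ge

theorem Rinv_add_natCast (ρ t : ℝ) (y : ℤ) (i : ℕ) :
    Rinv ρ t (y + i) y = Real.exp t * (((1 - ρ) * -t) ^ i / i.factorial) := by
  rw [Rinv, if_pos (by omega), add_sub_cancel_left, Int.toNat_natCast, zpow_natCast, mul_pow]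
  ring

theorem tsum_Qinv_mul (ρ : ℝ) (x : ℤ) (g : ℤ → ℝ) :
    ∑' z, Qinv ρ x z * g z = (1 / ρ) * g (x + 1) - ((1 - ρ) / ρ) * g x := by
  rw [tsum_eq_sum (s := {x, x + 1})]
  · rw [Finset.sum_pair (by omega)]
    have hx : x ≠ x - 1 := by omega
    simp [Qinv, hx]
    ring
  · intro z hz
    simp only [Finset.mem_insert, Finset.mem_singleton, not_or] at hz
    have h₁ : x ≠ z - 1 := by omega
    have h₂ : x ≠ z := by omega
    simp [Qinv, h₁, h₂]

theorem Qinvpow_succ (ρ : ℝ) (k : ℕ) (x y : ℤ) :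
    Qinvpow ρ (k + 1) x y
      = (1 / ρ) * Qinvpow ρ k (x + 1) y - ((1 - ρ) / ρ) * Qinvpow ρ k x y :=
  tsum_Qinv_mul ρ x fun z => Qinvpow ρ k z y

theorem Qinvpow_add_one_add_one (ρ : ℝ) (k : ℕ) (x y : ℤ) :
    Qinvpow ρ k (x + 1) (y + 1) = Qinvpow ρ k x y := by
  induction k generalizing x with
  | zero => simp [Qinvpow]
  | succ k ih => rw [Qinvpow_succ, Qinvpow_succ, ih, ih]

theorem Qinvpow_succ' (ρ : ℝ) (k : ℕ) (x y : ℤ) :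
    Qinvpow ρ (k + 1) x y
      = (1 / ρ) * Qinvpow ρ k x (y - 1) - ((1 - ρ) / ρ) * Qinvpow ρ k x y := by
  rw [Qinvpow_succ, ← Qinvpow_add_one_add_one ρ k x (y - 1), sub_add_cancel]

theorem Qinvpow_eq_zero_of_lt {ρ : ℝ} {k : ℕ} {x y : ℤ} (hxy : y < x) :
    Qinvpow ρ k x y = 0 := by
  induction k generalizing x with
  | zero => simp [Qinvpow, hxy.ne']
  | succ k ih => rw [Qinvpow_succ, ih hxy, ih (by omega)]; ring

theorem Qinvpow_eq_zero_of_add_lt {ρ : ℝ} {k : ℕ} {x y : ℤ} (hxy : x + k < y) :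
    Qinvpow ρ k x y = 0 := by
  induction k generalizing x with
  | zero => simp only [Nat.cast_zero, add_zero] at hxy; simp [Qinvpow, hxy.ne]
  | succ k ih => push_cast at hxy; rw [Qinvpow_succ, ih (by omega), ih (by omega)]; ring

theorem summable_Qinvpow_mul (ρ : ℝ) (k : ℕ) (x : ℤ) (f : ℤ → ℝ) :
    Summable fun z => Qinvpow ρ k x z * f z := by
  refine summable_of_ne_finset_zero (s := Finset.Icc x (x + k)) fun z hz => ?_
  rw [Finset.mem_Icc, not_and_or, not_le, not_le] at hz
  rcases hz with hz | hz
  · rw [Qinvpow_eq_zero_of_lt hz, zero_mul]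
  · rw [Qinvpow_eq_zero_of_add_lt hz, zero_mul]

theorem tsum_Qinvpow_succ_mul (ρ : ℝ) (k : ℕ) (x : ℤ) (f : ℤ → ℝ) :
    ∑' z, Qinvpow ρ (k + 1) x z * f z
      = ∑' z, Qinvpow ρ k x z * ((1 / ρ) * f (z + 1) - ((1 - ρ) / ρ) * f z) := by
  have hs := (summable_Qinvpow_mul ρ k x fun z => f (z + 1)).mul_left (1 / ρ)
  have hs' := (summable_Qinvpow_mul ρ k x f).mul_left ((1 - ρ) / ρ)
  have hshift : Summable fun z => (1 / ρ) * (Qinvpow ρ k x (z - 1) * f z) := by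
    rw [← (Equiv.addRight (1 : ℤ)).summable_iff]
    simpa [Function.comp_def] using hs
  calc ∑' z, Qinvpow ρ (k + 1) x z * f z
      = ∑' z, ((1 / ρ) * (Qinvpow ρ k x (z - 1) * f z)
          - ((1 - ρ) / ρ) * (Qinvpow ρ k x z * f z)) :=
        tsum_congr fun z => by rw [Qinvpow_succ']; ring
    _ = ∑' z, (1 / ρ) * (Qinvpow ρ k x (z - 1) * f z)
          - ∑' z, ((1 - ρ) / ρ) * (Qinvpow ρ k x z * f z) := hshift.tsum_sub hs'
    _ = ∑' z, (1 / ρ) * (Qinvpow ρ k x z * f (z + 1))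
          - ∑' z, ((1 - ρ) / ρ) * (Qinvpow ρ k x z * f z) := by
        rw [← (Equiv.addRight (1 : ℤ)).tsum_eq]
        simp
    _ = ∑' z, ((1 / ρ) * (Qinvpow ρ k x z * f (z + 1))
          - ((1 - ρ) / ρ) * (Qinvpow ρ k x z * f z)) := (hs.tsum_sub hs').symm
    _ = _ := tsum_congr fun z => by ring

theorem Qpow_succ (ρ : ℝ) (m : ℕ) (x y : ℤ) :
    Qpow ρ (m + 1) x y = ∑' z, Qker ρ x z * Qpow ρ m z y := by
  cases m with
  | zero =>
    rw [tsum_eq_single y fun z hz => by simp [Qpow, hz]]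
    simp [Qpow]
  | succ m => rfl

theorem Qpow_eq_zero {ρ : ℝ} {m : ℕ} {x y : ℤ} (hxy : x < y) : Qpow ρ m x y = 0 := by
  induction m generalizing x with
  | zero => simp [Qpow, hxy.ne]
  | succ m ih =>
    rw [Qpow_succ, ← tsum_zero (β := ℤ)]
    refine tsum_congr fun z => ?_
    rcases lt_or_ge z y with hz | hz
    · rw [ih hz, mul_zero]
    · rw [Qker_eq_zero (by omega), zero_mul]

theorem Qker_recursion {ρ : ℝ} (hρ : ρ ≠ 0) (hρ' : 1 - ρ ≠ 0) (z w : ℤ) :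
    (1 / ρ) * Qker ρ (z + 1) w - ((1 - ρ) / ρ) * Qker ρ z w = if z = w then 1 else 0 := by
  rcases lt_trichotomy z w with hlt | rfl | hgt
  · rw [Qker_eq_zero hlt.le, Qker_eq_zero (by omega), if_neg hlt.ne]; ring
  · rw [Qker_eq_zero le_rfl, if_pos rfl]
    simp [Qker, hρ]
  · rw [if_neg hgt.ne', Qker, Qker, if_pos hgt, if_pos (by omega),
      show z + 1 - w - 1 = (z - w - 1) + 1 by ring, zpow_add_one₀ hρ']
    ring

theorem Qpow_recursion {ρ : ℝ} (hρ : ρ ≠ 0) (hρ' : 1 - ρ ≠ 0) (m : ℕ) (z y : ℤ) :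
    (1 / ρ) * Qpow ρ (m + 1) (z + 1) y - ((1 - ρ) / ρ) * Qpow ρ (m + 1) z y
      = Qpow ρ m z y := by
  have hsum (x : ℤ) (hx : x ≤ z + 1) : Qpow ρ (m + 1) x y
      = ∑ w ∈ Finset.Icc y z, Qker ρ x w * Qpow ρ m w y := by
    rw [Qpow_succ, tsum_eq_sum]
    intro w hw
    rw [Finset.mem_Icc, not_and_or, not_le, not_le] at hw
    rcases hw with hw | hw
    · rw [Qpow_eq_zero hw, mul_zero]
    · rw [Qker_eq_zero (by omega), zero_mul]
  rw [hsum _ le_rfl, hsum z (by omega), Finset.mul_sum, Finset.mul_sum,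
    ← Finset.sum_sub_distrib]
  calc _ = ∑ w ∈ Finset.Icc y z, if z = w then Qpow ρ m w y else 0 :=
        Finset.sum_congr rfl fun w _ => by
          rw [← mul_assoc, ← mul_assoc, ← sub_mul, Qker_recursion hρ hρ', ite_mul, one_mul,
            zero_mul]
    _ = Qpow ρ m z y := by
        rw [Finset.sum_ite_eq]
        split_ifs with hz
        · rfl
        · rw [Qpow_eq_zero (by simpa using hz)]

theorem tsum_Qinvpow_mul_Qpow {ρ : ℝ} (hρ : ρ ≠ 0) (hρ' : 1 - ρ ≠ 0) (k m : ℕ) (x y : ℤ) :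
    ∑' z, Qinvpow ρ (k + m) x z * Qpow ρ m z y = Qinvpow ρ k x y := by
  induction m with
  | zero =>
    rw [tsum_eq_single y fun z hz => by simp [Qpow, hz]]
    simp [Qpow]
  | succ m ih =>
    rw [← add_assoc, tsum_Qinvpow_succ_mul]
    simpa only [Qpow_recursion hρ hρ'] using ih

theorem RQinv_eq_zero {ρ t : ℝ} {n : ℕ} {x z : ℤ} (hz : x + n < z) : RQinv ρ t n x z = 0 := by
  rw [RQinv, ← tsum_zero (β := ℤ)]
  refine tsum_congr fun y => ?_
  rcases lt_or_ge x y with hy | hy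
  · rw [Rker_eq_zero hy, zero_mul]
  · rw [Qinvpow_eq_zero_of_add_lt (by omega), mul_zero]

theorem RQinv_mul_Qpow_eq_zero {ρ t : ℝ} {n m : ℕ} {x y z : ℤ}
    (hz : z ∉ Finset.Icc y (x + n)) : RQinv ρ t n x z * Qpow ρ m z y = 0 := by
  rw [Finset.mem_Icc, not_and_or, not_le, not_le] at hz
  rcases hz with hz | hz
  · rw [Qpow_eq_zero hz, mul_zero]
  · rw [RQinv_eq_zero hz, zero_mul]

theorem Rker_mul_Qinvpow_eq_zero {ρ t : ℝ} {n k : ℕ} (hk : k ≤ n) {x X z y : ℤ} (hz : X ≤ z)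
    (hy : y ∉ Finset.Icc (X - n) x) : Rker ρ t x y * Qinvpow ρ k y z = 0 := by
  rw [Finset.mem_Icc, not_and_or, not_le, not_le] at hy
  rcases hy with hy | hy
  · rw [Qinvpow_eq_zero_of_add_lt (by omega), mul_zero]
  · rw [Rker_eq_zero hy, zero_mul]

theorem tsum_RQinv_mul_Qpow {ρ : ℝ} (hρ : ρ ≠ 0) (hρ' : 1 - ρ ≠ 0) (t : ℝ) (k m : ℕ)
    (x X : ℤ) :
    ∑' z, RQinv ρ t (k + m) x z * Qpow ρ m z X = ∑' y, Rker ρ t x y * Qinvpow ρ k y X := by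
  rw [tsum_eq_sum fun z hz => RQinv_mul_Qpow_eq_zero hz,
    tsum_eq_sum fun y hy =>
      Rker_mul_Qinvpow_eq_zero (Nat.le_add_right k m) (le_refl X) hy]
  calc _ = ∑ z ∈ Finset.Icc X (x + (k + m : ℕ)), ∑ y ∈ Finset.Icc (X - (k + m : ℕ)) x,
          Rker ρ t x y * (Qinvpow ρ (k + m) y z * Qpow ρ m z X) := by
        refine Finset.sum_congr rfl fun z hz => ?_
        rw [RQinv, tsum_eq_sum fun y hy =>
          Rker_mul_Qinvpow_eq_zero le_rfl (Finset.mem_Icc.1 hz).1 hy, Finset.sum_mul]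
        exact Finset.sum_congr rfl fun y _ => mul_assoc _ _ _
    _ = _ := by
        rw [Finset.sum_comm]
        refine Finset.sum_congr rfl fun y hy => ?_
        rw [← Finset.mul_sum, ← tsum_Qinvpow_mul_Qpow hρ hρ' k m, tsum_eq_sum]
        intro z hz
        rw [Finset.mem_Icc] at hy
        rw [Finset.mem_Icc, not_and_or, not_le, not_le] at hz
        rcases hz with hz | hz
        · rw [Qpow_eq_zero hz, mul_zero]
        · rw [Qinvpow_eq_zero_of_add_lt (by omega), zero_mul]

/-- A solution of the backwards-heat problem grows at most geometrically to the right. -/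
theorem SolvesIBVP.exists_bound {ρ : ℝ} (hρ : ρ ∈ Set.Ioo (0 : ℝ) 1) {n k : ℕ} {X₀ : ℕ → ℤ}
    {h : ℕ → ℤ → ℝ} (hh : SolvesIBVP ρ n k X₀ h) (z₀ : ℤ) :
    ∃ C, ∀ i : ℕ, |h 0 (z₀ + i)| ≤ C * (2 / (1 - ρ)) ^ i := by
  obtain ⟨hρ₀, hρ₁⟩ := hρ
  have ha : 0 < 1 - ρ := by linarith
  obtain ⟨hrec, hbdry, -⟩ := hh
  suffices ∀ j ≤ k, ∃ C, 0 ≤ C ∧ ∀ i : ℕ, |h (k - j) (z₀ + i)| ≤ C * (2 / (1 - ρ)) ^ i by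
    obtain ⟨C, -, hC⟩ := this k le_rfl
    rw [Nat.sub_self] at hC
    exact ⟨C, hC⟩
  intro j hj
  induction j with
  | zero =>
    refine ⟨ρ * (1 - ρ) ^ (X₀ (n - k) - z₀ - 1), by positivity, fun i => ?_⟩
    rw [Nat.sub_zero, hbdry, abs_of_pos (by positivity), mul_assoc,
      show X₀ (n - k) - (z₀ + i) - 1 = X₀ (n - k) - z₀ - 1 - (i : ℤ) by ring,
      zpow_sub₀ ha.ne', zpow_natCast, div_eq_mul_inv, ← inv_pow]
    gcongr
    rw [inv_eq_one_div]
    gcongr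
    norm_num
  | succ j ih =>
    obtain ⟨C, hC₀, hC⟩ := ih (by omega)
    obtain ⟨l, hl⟩ : ∃ l, k = l + j + 1 := ⟨k - (j + 1), by omega⟩
    rw [show k - j = l + 1 by omega] at hC
    rw [show k - (j + 1) = l by omega]
    refine ⟨|h l z₀| + 2 / (1 - ρ) * C, by positivity, fun i => ?_⟩
    induction i with
    | zero => simpa using by positivity
    | succ i ihi =>
      have hstep : h l (z₀ + (i + 1 : ℕ))
          = (1 / (1 - ρ)) * (h l (z₀ + i) - ρ * h (l + 1) (z₀ + (i + 1 : ℕ))) := by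
        have := hrec l (by omega) (z₀ + (i + 1 : ℕ))
        rw [show z₀ + ((i + 1 : ℕ) : ℤ) - 1 = z₀ + i by push_cast; ring] at this
        rw [← this]
        field_simp
        ring
      calc |h l (z₀ + (i + 1 : ℕ))|
          ≤ (1 / (1 - ρ)) * (|h l (z₀ + i)| + 1 * |h (l + 1) (z₀ + (i + 1 : ℕ))|) := by
            rw [hstep, abs_mul, abs_of_pos (by positivity : 0 < 1 / (1 - ρ))]
            gcongr
            refine (abs_sub _ _).trans ?_
            rw [abs_mul, abs_of_pos hρ₀]
            gcongr
        _ ≤ (1 / (1 - ρ)) * ((|h l z₀| + 2 / (1 - ρ) * C) * (2 / (1 - ρ)) ^ i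
              + 1 * (C * (2 / (1 - ρ)) ^ (i + 1))) := by
            gcongr
            exact hC (i + 1)
        _ ≤ (1 / (1 - ρ)) * (2 * ((|h l z₀| + 2 / (1 - ρ) * C) * (2 / (1 - ρ)) ^ i)) := by
            gcongr
            have : 0 ≤ |h l z₀| * (2 / (1 - ρ)) ^ i := by positivity
            rw [pow_succ]
            linarith
        _ = _ := by rw [pow_succ]; ring

theorem SolvesIBVP.summable_mul_Rinv {ρ : ℝ} (hρ : ρ ∈ Set.Ioo (0 : ℝ) 1) (t : ℝ) {n k : ℕ}
    {X₀ : ℕ → ℤ} {h : ℕ → ℤ → ℝ} (hh : SolvesIBVP ρ n k X₀ h) (y : ℤ) :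
    Summable fun z => h 0 z * Rinv ρ t z y := by
  obtain ⟨C, hC⟩ := hh.exists_bound hρ y
  have ha : 0 < 1 - ρ := by linarith [hρ.2]
  have hinj : Function.Injective fun i : ℕ => y + (i : ℤ) := fun i j hij => by
    simpa using hij
  rw [← hinj.summable_iff]
  · refine Summable.of_norm_bounded
      (g := fun i : ℕ => C * Real.exp t * ((2 * |t|) ^ i / i.factorial))
      ((Real.summable_pow_div_factorial _).mul_left _) fun i => ?_
    have hR : |Rinv ρ t (y + i) y| = Real.exp t * (((1 - ρ) * |t|) ^ i / i.factorial) := by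
      rw [Rinv_add_natCast, abs_mul, abs_div, abs_pow, abs_mul, abs_neg, abs_of_pos ha,
        Real.abs_exp, Nat.abs_cast]
    rw [Function.comp_apply, Real.norm_eq_abs, abs_mul, hR]
    calc _ ≤ C * (2 / (1 - ρ)) ^ i * (Real.exp t * (((1 - ρ) * |t|) ^ i / i.factorial)) := by
          gcongr
          exact hC i
      _ = C * Real.exp t * ((2 / (1 - ρ) * ((1 - ρ) * |t|)) ^ i / i.factorial) := by
          rw [mul_pow (2 / (1 - ρ))]; ring
      _ = _ := by rw [← mul_assoc, div_mul_cancel₀ _ ha.ne']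
  · intro z hz
    rw [Rinv_eq_zero, mul_zero]
    by_contra! hle
    exact hz ⟨(z - y).toNat, by simp; omega⟩

theorem stmt19 (ρ : ℝ) (hρ : ρ ∈ Set.Ioo (0 : ℝ) 1) (t : ℝ) (ht : 0 < t)
    (n : ℕ) (hn : 1 ≤ n)
    (X₀ : ℕ → ℤ) (hX : ∀ i j : ℕ, 1 ≤ i → i < j → j ≤ n → X₀ j < X₀ i)
    (h : ℕ → ℕ → ℤ → ℝ) (hh : ∀ k, k ≤ n - 1 → SolvesIBVP ρ n k X₀ (h k))
    (x y : ℤ) :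
    (∀ z₂ : ℤ, {z₁ : ℤ | RQinv ρ t n x z₁ * Gop ρ n X₀ h z₁ z₂ ≠ 0}.Finite) ∧
    Summable (fun z₂ : ℤ =>
      |(∑' z₁ : ℤ, RQinv ρ t n x z₁ * Gop ρ n X₀ h z₁ z₂) * Rinv ρ t z₂ y|) ∧
    (∑ k ∈ Finset.range n, Psi ρ t n k X₀ x * Phi ρ t (h k 0) y)
      = ∑' z₂ : ℤ, (∑' z₁ : ℤ, RQinv ρ t n x z₁ * Gop ρ n X₀ h z₁ z₂) * Rinv ρ t z₂ y := by
  have hρ₀ : ρ ≠ 0 := hρ.1.ne'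
  have hρ₁ : 1 - ρ ≠ 0 := sub_ne_zero.2 hρ.2.ne'
  have hterm (z₁ z₂ : ℤ) : RQinv ρ t n x z₁ * Gop ρ n X₀ h z₁ z₂
      = ∑ k ∈ Finset.range n, ((1 - ρ) / ρ) * h k 0 z₂
          * (RQinv ρ t n x z₁ * Qpow ρ (n - k) z₁ (X₀ (n - k))) := by
    rw [Gop, Finset.mul_sum]
    exact Finset.sum_congr rfl fun k _ => by ring
  have hsupp (k : ℕ) : {z₁ : ℤ |
      RQinv ρ t n x z₁ * Qpow ρ (n - k) z₁ (X₀ (n - k)) ≠ 0}.Finite :=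
    (Finset.Icc (X₀ (n - k)) (x + n)).finite_toSet.subset fun z hz => by
      by_contra hmem
      exact hz (RQinv_mul_Qpow_eq_zero hmem)
  have hinner (z₂ : ℤ) : ∑' z₁ : ℤ, RQinv ρ t n x z₁ * Gop ρ n X₀ h z₁ z₂
      = ∑ k ∈ Finset.range n, ((1 - ρ) / ρ) * h k 0 z₂ * Psi ρ t n k X₀ x := by
    simp only [hterm]
    rw [Summable.tsum_finsetSum fun k _ => (summable_of_hasFiniteSupport (hsupp k)).mul_left _]
    refine Finset.sum_congr rfl fun k hk => ?_
    have hkn : k + (n - k) = n := Nat.add_sub_cancel' (Finset.mem_range.1 hk).le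
    have hPsi := tsum_RQinv_mul_Qpow hρ₀ hρ₁ t k (n - k) x (X₀ (n - k))
    rw [hkn] at hPsi
    rw [tsum_mul_left, hPsi, Psi]
  have hsum (k : ℕ) (hk : k ∈ Finset.range n) :
      Summable fun z₂ => ((1 - ρ) / ρ) * h k 0 z₂ * Rinv ρ t z₂ y := by
    have hk' := Finset.mem_range.1 hk
    simpa only [mul_assoc] using
      ((hh k (by omega)).summable_mul_Rinv hρ t y).mul_left ((1 - ρ) / ρ)
  have houter (z₂ : ℤ) : (∑' z₁ : ℤ, RQinv ρ t n x z₁ * Gop ρ n X₀ h z₁ z₂) * Rinv ρ t z₂ y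
      = ∑ k ∈ Finset.range n,
          Psi ρ t n k X₀ x * (((1 - ρ) / ρ) * h k 0 z₂ * Rinv ρ t z₂ y) := by
    rw [hinner, Finset.sum_mul]
    exact Finset.sum_congr rfl fun k _ => by ring
  refine ⟨fun z₂ => ?_, ?_, ?_⟩
  · refine ((Finset.range n).finite_toSet.biUnion fun k _ => hsupp k).subset fun z₁ hz₁ => ?_
    rw [Set.mem_ofPred_eq, hterm] at hz₁
    obtain ⟨k, hk, hne⟩ := Finset.exists_ne_zero_of_sum_ne_zero hz₁
    exact Set.mem_biUnion hk (right_ne_zero_of_mul hne)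
  · simp only [houter]
    exact (summable_sum fun k hk => (hsum k hk).mul_left _).abs
  · simp only [houter]
    rw [Summable.tsum_finsetSum fun k hk => (hsum k hk).mul_left _]
    exact Finset.sum_congr rfl fun k _ => by rw [tsum_mul_left, Phi]
end
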